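/- Let r ≥ 1 and let M be an (m/2) × (m/2) matrix with entries in {0,1} whose every row sum and every column sum equals r, such that the bipartite graph with bi-adjacency matrix M is connected. Let μ, ν > 0 with μ + ν = 1, and let S be the m × m real block matrix S = [[rνI, −μM],[−νMᵀ, rμI]]. Then: (a) every complex eigenvalue λ of S is either real or satisfies Re λ = r/2; (b) every real eigenvalue of S is at most r; and (c) r is an eigenvalue of S whose eigenspace is one-dimensional. Consequently, for the vector field F of the α = 1 model on a finite connected r-regular bipartite graph, at any point v in the interior of Ω (so v_i = p on A, v_i = q on B with p,q > 0, p+q = 2/m, μ = p/(p+q), ν = q/(p+q)), the Jacobian JF(v) = −I + (1/r)S has the property that every eigenvalue of JF(v) other than 0 has negative real part and 0 is a simple eigenvalue. -/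

import Mathlib

open MeasureTheory Filter Topology

/-- The bipartite graph on `Fin k ⊕ Fin k` whose bi-adjacency matrix is `M`. -/
def biAdjGraph {k : ℕ} (M : Matrix (Fin k) (Fin k) ℝ) : SimpleGraph (Fin k ⊕ Fin k) :=
  SimpleGraph.fromRel fun a b => ∃ i j, a = Sum.inl i ∧ b = Sum.inr j ∧ M i j = 1

open ComplexConjugate in
lemma key_identity {𝕜 : Type*} [RCLike 𝕜] {k : ℕ} (r : ℝ) (M : Matrix (Fin k) (Fin k) ℝ)
    (hrow : ∀ i, ∑ j, M i j = r) (hcol : ∀ j, ∑ i, M i j = r)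
    (μ ν : ℝ) (hμν : μ + ν = 1) (lam : 𝕜) (x y : Fin k → 𝕜)
    (h1 : ∀ i, (r : 𝕜) * ν * x i - μ * ∑ j, (M i j : 𝕜) * y j = lam * x i)
    (h2 : ∀ j, -(ν * ∑ i, (M i j : 𝕜) * x i) + (r : 𝕜) * μ * y j = lam * y j) :
    ((r : 𝕜) - lam) * ((ν * (∑ i, ‖x i‖ ^ 2) + μ * (∑ j, ‖y j‖ ^ 2) : ℝ) : 𝕜) =
      ((μ * ν * ∑ i, ∑ j, M i j * ‖x i + y j‖ ^ 2 : ℝ) : 𝕜) := by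
  have hμν' : (μ : 𝕜) + ν = 1 := by exact_mod_cast congrArg (RCLike.ofReal (K := 𝕜)) hμν
  have e1 : ∀ i, ((r : 𝕜) - lam) * x i = μ * ∑ j, (M i j : 𝕜) * (x i + y j) := by
    intro i
    have : ∑ j, (M i j : 𝕜) = r := by rw [← hrow i]; push_cast; rfl
    simp only [mul_add, Finset.sum_add_distrib, ← Finset.sum_mul, this]
    linear_combination (- (r : 𝕜) * x i) * hμν' + h1 i
  have e2 : ∀ j, ((r : 𝕜) - lam) * y j = ν * ∑ i, (M i j : 𝕜) * (x i + y j) := by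
    intro j
    have : ∑ i, (M i j : 𝕜) = r := by rw [← hcol j]; push_cast; rfl
    simp only [mul_add, Finset.sum_add_distrib, ← Finset.sum_mul, this]
    linear_combination (- (r : 𝕜) * y j) * hμν' + h2 j
  push_cast
  simp only [← RCLike.conj_mul]
  have f1 : ((r : 𝕜) - lam) * (ν * ∑ i, conj (x i) * x i) =
      ∑ i, ∑ j, μ * ν * ((M i j : 𝕜) * (conj (x i) * (x i + y j))) := by
    rw [Finset.mul_sum, Finset.mul_sum]
    refine Finset.sum_congr rfl fun i _ => ?_
    calc _ = ν * conj (x i) * (((r : 𝕜) - lam) * x i) := by ring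
      _ = _ := by
        rw [e1, Finset.mul_sum, Finset.mul_sum]
        exact Finset.sum_congr rfl fun j _ => by ring
  have f2 : ((r : 𝕜) - lam) * (μ * ∑ j, conj (y j) * y j) =
      ∑ i, ∑ j, μ * ν * ((M i j : 𝕜) * (conj (y j) * (x i + y j))) := by
    rw [Finset.sum_comm, Finset.mul_sum, Finset.mul_sum]
    refine Finset.sum_congr rfl fun j _ => ?_
    calc _ = μ * conj (y j) * (((r : 𝕜) - lam) * y j) := by ring
      _ = _ := by
        rw [e2, Finset.mul_sum, Finset.mul_sum]
        exact Finset.sum_congr rfl fun i _ => by ring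
  rw [mul_add, f1, f2, ← Finset.sum_add_distrib, Finset.mul_sum]
  refine Finset.sum_congr rfl fun i _ => ?_
  rw [← Finset.sum_add_distrib, Finset.mul_sum]
  refine Finset.sum_congr rfl fun j _ => ?_
  rw [map_add]; ring

lemma eigvec_of_spectrum {K n : Type*} [Field K] [Fintype n] [DecidableEq n]
    (A : Matrix n n K) (lam : K) (h : lam ∈ spectrum K A) :
    ∃ v : n → K, v ≠ 0 ∧ A.mulVec v = lam • v := by
  rw [← Matrix.spectrum_toLin', ← Module.End.hasEigenvalue_iff_mem_spectrum] at h
  obtain ⟨v, hv⟩ := h.exists_hasEigenvector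
  exact ⟨v, hv.2, by simpa using hv.apply_eq_smul⟩

lemma spectrum_of_eigvec {K n : Type*} [Field K] [Fintype n] [DecidableEq n]
    (A : Matrix n n K) (lam : K) (v : n → K) (hv : v ≠ 0) (h : A.mulVec v = lam • v) :
    lam ∈ spectrum K A := by
  rw [← Matrix.spectrum_toLin', ← Module.End.hasEigenvalue_iff_mem_spectrum]
  refine Module.End.hasEigenvalue_of_hasEigenvector (x := v) ⟨?_, hv⟩
  rw [Module.End.mem_eigenspace_iff]
  simpa using h

lemma eigen_identity {𝕜 : Type*} [RCLike 𝕜] {k : ℕ} (r : ℝ) (M : Matrix (Fin k) (Fin k) ℝ)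
    (hrow : ∀ i, ∑ j, M i j = r) (hcol : ∀ j, ∑ i, M i j = r)
    (μ ν : ℝ) (hμν : μ + ν = 1) (lam : 𝕜) (v : Fin k ⊕ Fin k → 𝕜)
    (h : ((Matrix.fromBlocks ((r * ν) • 1) ((-μ) • M) ((-ν) • M.transpose)
      ((r * μ) • 1)).map (algebraMap ℝ 𝕜)).mulVec v = lam • v) :
    ((r : 𝕜) - lam) * ((ν * (∑ i, ‖v (.inl i)‖ ^ 2) + μ * (∑ j, ‖v (.inr j)‖ ^ 2) : ℝ) : 𝕜) =
      ((μ * ν * ∑ i, ∑ j, M i j * ‖v (.inl i) + v (.inr j)‖ ^ 2 : ℝ) : 𝕜) := by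
  apply key_identity r M hrow hcol μ ν hμν
  · intro i
    have := congrFun h (.inl i)
    simp [Matrix.mulVec, dotProduct, Matrix.one_apply, Finset.mul_sum, apply_ite, ite_mul] at this
    rw [← this, Finset.mul_sum, sub_eq_add_neg]
    congr 2
    exact Finset.sum_congr rfl fun j _ => by rw [mul_assoc]
  · intro j
    have := congrFun h (.inr j)
    simp [Matrix.mulVec, dotProduct, Matrix.one_apply, Finset.mul_sum, apply_ite, ite_mul] at this
    rw [← this, Finset.mul_sum]
    congr 2
    exact Finset.sum_congr rfl fun j _ => by rw [mul_assoc]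

lemma weight_pos {𝕜 : Type*} [RCLike 𝕜] {k : ℕ} (μ ν : ℝ) (hμ : 0 < μ) (hν : 0 < ν)
    (v : Fin k ⊕ Fin k → 𝕜) (hv : v ≠ 0) :
    0 < ν * (∑ i, ‖v (.inl i)‖ ^ 2) + μ * (∑ j, ‖v (.inr j)‖ ^ 2) := by
  obtain ⟨a, ha⟩ := Function.ne_iff.1 hv
  have n1 : 0 ≤ ∑ i, ‖v (.inl i)‖ ^ 2 := Finset.sum_nonneg fun _ _ => by positivity
  have n2 : 0 ≤ ∑ i, ‖v (.inr i)‖ ^ 2 := Finset.sum_nonneg fun _ _ => by positivity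
  have ha' : 0 < ‖v a‖ ^ 2 := by
    have := norm_pos_iff.2 ha
    positivity
  rcases a with i | j
  · have : 0 < ∑ i, ‖v (.inl i)‖ ^ 2 :=
      ha'.trans_le (Finset.single_le_sum (f := fun i => ‖v (.inl i)‖ ^ 2)
        (fun _ _ => by positivity) (Finset.mem_univ i))
    positivity
  · have : 0 < ∑ i, ‖v (.inr i)‖ ^ 2 :=
      ha'.trans_le (Finset.single_le_sum (f := fun i => ‖v (.inr i)‖ ^ 2)
        (fun _ _ => by positivity) (Finset.mem_univ j))
    positivity

/-- **Lemma (spectrum of the Jacobian on `Ω`).** Let `M` be a `0`-`1` matrix with all row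
and column sums `r ≥ 1` whose bipartite graph is connected, let `μ, ν > 0` with
`μ + ν = 1`, and let `S = [[rνI, -μM], [-νM.transpose, rμI]]`. Then (a) every complex eigenvalue of
`S` is real or has real part `r/2`; (b) every real eigenvalue of `S` is at most `r`;
(c) `r` is an eigenvalue of `S` with one-dimensional eigenspace. Consequently, the Jacobian
`JF(v) = -I + (1/r) S` of the `α = 1` vector field at an interior point `v` of `Ω` has all
its nonzero eigenvalues of negative real part, and `0` is a simple eigenvalue. -/
theorem bipartite_jacobian_spectrum
    {k r : ℕ} (hr : 1 ≤ r) (M : Matrix (Fin k) (Fin k) ℝ)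
    (hM01 : ∀ i j, M i j = 0 ∨ M i j = 1)
    (hrow : ∀ i, ∑ j, M i j = (r : ℝ)) (hcol : ∀ j, ∑ i, M i j = (r : ℝ))
    (hconn : (biAdjGraph M).Connected)
    (μ ν : ℝ) (hμ : 0 < μ) (hν : 0 < ν) (hμν : μ + ν = 1)
    (S : Matrix (Fin k ⊕ Fin k) (Fin k ⊕ Fin k) ℝ)
    (hS : S = Matrix.fromBlocks (((r : ℝ) * ν) • 1) ((-μ) • M) ((-ν) • M.transpose) (((r : ℝ) * μ) • 1)) :
    (∀ lam ∈ spectrum ℂ (S.map (algebraMap ℝ ℂ)), lam.im = 0 ∨ lam.re = (r : ℝ) / 2) ∧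
    (∀ lam ∈ spectrum ℝ S, lam ≤ (r : ℝ)) ∧
    ((r : ℝ) ∈ spectrum ℝ S ∧
      Module.finrank ℝ ↥(Module.End.eigenspace (Matrix.toLin' S) (r : ℝ)) = 1) ∧
    (∀ lam ∈ spectrum ℂ
        (((-1 : Matrix (Fin k ⊕ Fin k) (Fin k ⊕ Fin k) ℝ) + (r : ℝ)⁻¹ • S).map
          (algebraMap ℝ ℂ)),
      lam ≠ 0 → lam.re < 0) ∧
    ((0 : ℝ) ∈ spectrum ℝ ((-1 : Matrix (Fin k ⊕ Fin k) (Fin k ⊕ Fin k) ℝ) + (r : ℝ)⁻¹ • S) ∧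
      Module.finrank ℝ
        ↥(Module.End.eigenspace
          (Matrix.toLin' ((-1 : Matrix (Fin k ⊕ Fin k) (Fin k ⊕ Fin k) ℝ) + (r : ℝ)⁻¹ • S))
          (0 : ℝ)) = 1) := by
  have hM0 : ∀ i j, 0 ≤ M i j := fun i j => by rcases hM01 i j with h | h <;> simp [h]
  have hr0 : (0 : ℝ) < r := by exact_mod_cast hr
  have hQ : ∀ (v : Fin k ⊕ Fin k → ℂ),
      0 ≤ μ * ν * ∑ i, ∑ j, M i j * ‖v (.inl i) + v (.inr j)‖ ^ 2 := fun v => by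
    have : 0 ≤ ∑ i, ∑ j, M i j * ‖v (.inl i) + v (.inr j)‖ ^ 2 :=
      Finset.sum_nonneg fun i _ => Finset.sum_nonneg fun j _ =>
        mul_nonneg (hM0 i j) (by positivity)
    positivity
  -- all complex eigenvalues are real and at most `r`
  have hC : ∀ (lam : ℂ) (v : Fin k ⊕ Fin k → ℂ), v ≠ 0 →
      (S.map (algebraMap ℝ ℂ)).mulVec v = lam • v → lam.im = 0 ∧ lam.re ≤ r := by
    intro lam v hv h
    rw [hS] at h
    have hid := eigen_identity (r : ℝ) M hrow hcol μ ν hμν lam v h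
    have hw := weight_pos μ ν hμ hν v hv
    have hq := hQ v
    generalize ν * (∑ i, ‖v (.inl i)‖ ^ 2) + μ * (∑ j, ‖v (.inr j)‖ ^ 2) = W at *
    generalize μ * ν * ∑ i, ∑ j, M i j * ‖v (.inl i) + v (.inr j)‖ ^ 2 = Q at *
    have him := congrArg Complex.im hid
    have hre := congrArg Complex.re hid
    simp at him hre
    constructor
    · rcases him with h | h
      · exact h
      · exact absurd h hw.ne'
    · by_contra hlt
      push Not at hlt
      nlinarith
  have hSC : ∀ lam ∈ spectrum ℂ (S.map (algebraMap ℝ ℂ)), lam.im = 0 ∧ lam.re ≤ r := by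
    intro lam hl
    obtain ⟨v, hv, h⟩ := eigvec_of_spectrum _ _ hl
    exact hC lam v hv h
  -- the eigenspace
  have hnek : Nonempty (Fin k) := by
    obtain ⟨a⟩ := hconn.nonempty
    rcases a with i | i <;> exact ⟨i⟩
  let w : Fin k ⊕ Fin k → ℝ := Sum.elim (fun _ => 1) (fun _ => -1)
  have hw0 : w ≠ 0 := fun h => by
    have := congrFun h (.inl hnek.some)
    simp [w] at this
  have hwS : S.mulVec w = (r : ℝ) • w := by
    rw [hS, Matrix.fromBlocks_mulVec]
    ext a
    rcases a with i | j
    · have := hrow i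
      simp [w, Matrix.mulVec, dotProduct, Matrix.one_apply, Function.comp_def, ← Finset.mul_sum, this]
      linear_combination (r : ℝ) * hμν
    · have := hcol j
      simp [w, Matrix.mulVec, dotProduct, Matrix.one_apply, Function.comp_def, ← Finset.mul_sum, this]
      linear_combination -(r : ℝ) * hμν
  have huniq : ∀ v : Fin k ⊕ Fin k → ℝ, S.mulVec v = (r : ℝ) • v → ∃ c : ℝ, c • w = v := by
    intro v h
    have h' : (S.map (algebraMap ℝ ℝ)).mulVec v = (r : ℝ) • v := by
      rw [show S.map (algebraMap ℝ ℝ) = S by ext; simp]; exact h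
    rw [hS] at h'
    have hid := eigen_identity (𝕜 := ℝ) (r : ℝ) M hrow hcol μ ν hμν (r : ℝ) v h'
    have hnn : ∀ i j, 0 ≤ M i j * ‖v (.inl i) + v (.inr j)‖ ^ 2 := fun i j =>
      mul_nonneg (hM0 i j) (by positivity)
    have hq0 : ∑ i, ∑ j, M i j * ‖v (.inl i) + v (.inr j)‖ ^ 2 = 0 := by
      have : μ * ν ≠ 0 := by positivity
      have h0 : 0 = μ * ν * ∑ i, ∑ j, M i j * ‖v (.inl i) + v (.inr j)‖ ^ 2 := by
        simpa only [RCLike.ofReal_real_eq_id, id, sub_self, zero_mul] using hid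
      exact (mul_eq_zero.1 h0.symm).resolve_left this
    have hedge : ∀ i j, M i j = 1 → v (.inl i) = - v (.inr j) := by
      intro i j hij
      have a1 := (Finset.sum_eq_zero_iff_of_nonneg
        (fun i _ => Finset.sum_nonneg fun j _ => hnn i j)).1 hq0 i (Finset.mem_univ _)
      have a2 := (Finset.sum_eq_zero_iff_of_nonneg
        (fun j _ => hnn i j)).1 a1 j (Finset.mem_univ _)
      rw [hij, one_mul] at a2
      have a3 := norm_eq_zero.1 (pow_eq_zero_iff (two_ne_zero) |>.1 a2)
      linarith
    let g : Fin k ⊕ Fin k → ℝ := fun a => w a * v a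
    have hadj : ∀ a b, (biAdjGraph M).Adj a b → g a = g b := by
      intro a b hab
      rw [biAdjGraph, SimpleGraph.fromRel_adj] at hab
      rcases hab.2 with ⟨i, j, rfl, rfl, hij⟩ | ⟨i, j, rfl, rfl, hij⟩ <;>
        simp [g, w, hedge i j hij]
    have hwalk : ∀ a b, (biAdjGraph M).Walk a b → g a = g b := by
      intro a b p
      induction p with
      | nil => rfl
      | cons hh _ ih => exact (hadj _ _ hh).trans ih
    refine ⟨g (.inl hnek.some), ?_⟩
    ext a
    obtain ⟨p⟩ := hconn.preconnected (.inl hnek.some) a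
    have := hwalk _ _ p
    simp only [Pi.smul_apply, smul_eq_mul]
    rw [this]
    rcases a with i | j <;> simp [g, w]
  have hfin : Module.finrank ℝ ↥(Module.End.eigenspace (Matrix.toLin' S) (r : ℝ)) = 1 := by
    refine finrank_eq_one (⟨w, ?_⟩ : Module.End.eigenspace (Matrix.toLin' S) (r : ℝ)) ?_ ?_
    · rw [Module.End.mem_eigenspace_iff]; simpa using hwS
    · intro h; exact hw0 (congrArg Subtype.val h)
    · rintro ⟨v, hv⟩
      rw [Module.End.mem_eigenspace_iff] at hv
      obtain ⟨c, hc⟩ := huniq v (by simpa using hv)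
      exact ⟨c, Subtype.ext hc⟩
  have heig : Module.End.eigenspace
      (Matrix.toLin' ((-1 : Matrix (Fin k ⊕ Fin k) (Fin k ⊕ Fin k) ℝ) + (r : ℝ)⁻¹ • S)) (0 : ℝ)
      = Module.End.eigenspace (Matrix.toLin' S) (r : ℝ) := by
    ext v
    rw [Module.End.mem_eigenspace_iff, Module.End.mem_eigenspace_iff, Matrix.toLin'_apply,
      Matrix.toLin'_apply, Matrix.add_mulVec, Matrix.neg_mulVec, Matrix.one_mulVec,
      Matrix.smul_mulVec, zero_smul, neg_add_eq_zero, eq_comm, inv_smul_eq_iff₀ hr0.ne']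
  refine ⟨fun lam hl => Or.inl (hSC lam hl).1, ?_, ⟨spectrum_of_eigvec S r w hw0 hwS, hfin⟩,
    ?_, ?_, ?_⟩
  · intro lam hl
    obtain ⟨v, hv, h⟩ := eigvec_of_spectrum _ _ hl
    have := hC (lam : ℂ) (fun a => (v a : ℂ)) ?_ ?_
    · simpa using this.2
    · intro h0
      apply hv
      ext a
      simpa using congrFun h0 a
    · ext a
      have := congrArg (fun t : ℝ => (t : ℂ)) (congrFun h a)
      simpa [Matrix.mulVec, dotProduct] using this
  · intro lam hl hne
    obtain ⟨v, hv, h⟩ := eigvec_of_spectrum _ _ hl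
    have hmap : ((-1 : Matrix (Fin k ⊕ Fin k) (Fin k ⊕ Fin k) ℝ) + (r : ℝ)⁻¹ • S).map
        (algebraMap ℝ ℂ) = -1 + ((r : ℂ)⁻¹) • S.map (algebraMap ℝ ℂ) := by
      ext a b
      by_cases hab : a = b <;> simp [Matrix.one_apply, hab]
    have hrc : (r : ℂ) ≠ 0 := by exact_mod_cast hr0.ne'
    rw [hmap, Matrix.add_mulVec, Matrix.neg_mulVec, Matrix.one_mulVec, Matrix.smul_mulVec,
      neg_add_eq_iff_eq_add, inv_smul_eq_iff₀ hrc] at h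
    have h' : (S.map (algebraMap ℝ ℂ)).mulVec v = ((r : ℂ) * (1 + lam)) • v := by
      rw [h, mul_smul, add_smul, one_smul]
    have := hC _ v hv h'
    simp at this
    obtain ⟨hi, hre⟩ := this
    have hi' : lam.im = 0 := by
      rcases hi with h | h
      · exact absurd h (by exact_mod_cast hr0.ne')
      · exact h
    have hle : lam.re ≤ 0 := by nlinarith
    refine lt_of_le_of_ne hle fun h0 => hne (Complex.ext h0 hi')
  · refine spectrum_of_eigvec _ _ w hw0 ?_
    have : w ∈ Module.End.eigenspace (Matrix.toLin' S) (r : ℝ) := by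
      rw [Module.End.mem_eigenspace_iff]; simpa using hwS
    rw [← heig, Module.End.mem_eigenspace_iff] at this
    simpa only [Matrix.toLin'_apply] using this
  · rw [heig]; exact hfin
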